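/- arXiv:2003.02246 — 7 statements merged into one kernel-verified Lean document; each statement's English description precedes it below -/
import Mathlib

section
/- Let q be a prime power and let K be a field containing F_q as a subfield. Let r ∈ K satisfy r^q ≠ r (equivalently, r does not lie in the copy of F_q inside K). Then for every integer k with 1 ≤ k ≤ q, the sum over all x ∈ F_q of (x − r)^{−k} equals (r^q − r)^{−k}. -/
open Finset in
theorem FiniteField.sum_pow_card_sub_one (F : Type*) [Field F] [Fintype F] :
    ∑ x : F, x ^ (Fintype.card F - 1) = -1 := by
  classical
  have hcard : Fintype.card F - 1 ≠ 0 := (Nat.sub_pos_of_lt Fintype.one_lt_card).ne'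
  have h (x : F) : x ^ (Fintype.card F - 1) = 1 - if x = 0 then 1 else 0 := by
    split_ifs with hx
    · simp [hx, hcard]
    · simp [FiniteField.pow_card_sub_one_eq_one x hx]
  simp [h, sum_sub_distrib]

open Finset in
theorem FiniteField.sum_algebraMap_sub_pow {F K : Type*} [Field F] [Fintype F] [CommRing K]
    [Algebra F K] (r : K) {j : ℕ} (hj : j ≤ Fintype.card F - 1) :
    ∑ x : F, (algebraMap F K x - r) ^ j = algebraMap F K (∑ x : F, x ^ j) := by
  simp_rw [sub_eq_add_neg, add_pow]
  rw [sum_comm, sum_range_succ, sum_eq_zero, zero_add]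
  · simp
  · intro i hi
    have hi' : i < Fintype.card F - 1 := (mem_range.mp hi).trans_le hj
    simp_rw [← sum_mul, ← map_pow, ← map_sum, FiniteField.sum_pow_lt_card_sub_one F i hi']
    simp

theorem FiniteField.algebraMap_sub_pow_card {F K : Type*} [Field F] [Fintype F] [CommRing K]
    [Algebra F K] (x : F) (r : K) :
    (algebraMap F K x - r) ^ Fintype.card F = algebraMap F K x - r ^ Fintype.card F := by
  simpa only [FiniteField.coe_frobeniusAlgHom, AlgHom.commutes] using
    map_sub (FiniteField.frobeniusAlgHom F K) (algebraMap F K x) r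

/-- Carlitz's power sum formula (1935): for a field `K` containing `F_q` and `r ∈ K`
with `r ^ q ≠ r`, for every `1 ≤ k ≤ q`, `∑_{x ∈ F_q} (x - r)⁻ᵏ = (r ^ q - r)⁻ᵏ`. -/
theorem stmt_0 (q : ℕ) (hq : IsPrimePow q)
    (F : Type*) [Field F] [Fintype F] (hF : Fintype.card F = q)
    (K : Type*) [Field K] [Algebra F K]
    (r : K) (hr : r ^ q ≠ r)
    (k : ℕ) (hk1 : 1 ≤ k) (hk2 : k ≤ q) :
    ∑ x : F, ((algebraMap F K x - r) ^ k)⁻¹ = ((r ^ q - r) ^ k)⁻¹ := by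
  subst hF
  have hc : r ^ Fintype.card F - r ≠ 0 := sub_ne_zero.mpr hr
  have ha (x : F) : algebraMap F K x - r ≠ 0 := by
    intro h
    rw [← sub_eq_zero.mp h, ← map_pow, FiniteField.pow_card] at hr
    exact hr rfl
  have recurrence (m : ℕ) (hm : m + 1 ≤ Fintype.card F) :
      (r ^ Fintype.card F - r) * ∑ x : F, ((algebraMap F K x - r) ^ (m + 1))⁻¹ =
        ∑ x : F, ((algebraMap F K x - r) ^ m)⁻¹ -
          algebraMap F K (∑ x : F, x ^ (Fintype.card F - (m + 1))) := by
    rw [← FiniteField.sum_algebraMap_sub_pow r (by omega), Finset.mul_sum,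
      ← Finset.sum_sub_distrib]
    refine Finset.sum_congr rfl fun x _ ↦ ?_
    have hx := FiniteField.algebraMap_sub_pow_card x r
    rw [← Nat.sub_add_cancel hm, pow_add, Nat.sub_add_cancel hm] at hx
    have := ha x
    field_simp
    linear_combination (algebraMap F K x - r) ^ m * hx
  induction k, hk1 using Nat.le_induction with
  | base =>
    have h := recurrence 0 hk2
    rw [zero_add, FiniteField.sum_pow_card_sub_one] at h
    rw [pow_one, ← mul_right_inj' hc, mul_inv_cancel₀ hc, h]
    simp [← map_natCast (algebraMap F K)]
  | succ m hm ih =>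
    have h := recurrence m hk2
    rw [FiniteField.sum_pow_lt_card_sub_one F _ (by omega), map_zero, sub_zero,
      ih (by omega)] at h
    rw [pow_succ', mul_inv, ← h, inv_mul_cancel_left₀ hc]
end

section
/- Let q be a prime power, let r ∈ F_{q^2} with r ∉ F_q, and let b ∈ F_{q^2} with b ≠ 0. If the map from F_q to F_{q^2} sending x to x + b/(x − r) + b^q/(x − r^q) is injective, then b ∈ F_q, i.e., b^q = b. -/
open Polynomial in
theorem splits_X_pow_fintype_card_sub_X (F : Type*) [Field F] [Fintype F] :
    (X ^ Fintype.card F - X : F[X]).Splits := by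
  rw [splits_iff_card_roots, FiniteField.roots_X_pow_card_sub_X,
    FiniteField.X_pow_card_sub_X_natDegree_eq F Fintype.one_lt_card]
  rfl

open Polynomial in
/-- An element fixed by the `|F|`-power Frobenius lies in `F`. -/
theorem mem_range_algebraMap_of_pow_card_eq {F K : Type*} [Field F] [Fintype F] [Field K]
    [Algebra F K] {x : K} (hx : x ^ Fintype.card F = x) : x ∈ Set.range (algebraMap F K) := by
  refine (splits_X_pow_fintype_card_sub_X F).mem_range_of_isRoot
    (FiniteField.X_pow_card_sub_X_ne_zero F Fintype.one_lt_card) ?_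
  simp [IsRoot, hx]

open Polynomial in
/-- The sum of `1 / (z - x)` over `x ∈ F` is the logarithmic derivative of `X ^ |F| - X` at `z`. -/
theorem sum_one_div_sub_algebraMap {F K : Type*} [Field F] [Fintype F] [Field K]
    [Algebra F K] {z : K} (hz : z ^ Fintype.card F ≠ z) :
    ∑ x : F, 1 / (z - algebraMap F K x) = -1 / (z ^ Fintype.card F - z) := by
  have hsplits := splits_X_pow_fintype_card_sub_X F
  have hcard : (Fintype.card F : K) = 0 := by
    rw [← map_natCast (algebraMap F K), FiniteField.cast_card_eq_zero, map_zero]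
  have h := (hsplits.map (algebraMap F K)).eval_derivative_div_eval_of_ne_zero (x := z)
    (by simpa [sub_eq_zero] using hz)
  rw [hsplits.roots_map, FiniteField.roots_X_pow_card_sub_X, Multiset.map_map] at h
  simpa [hcard, derivative_X_pow] using h.symm

/-- If `x ↦ x + b/(x - r) + b^q/(x - r^q)` is injective on `F_q`, then `b ∈ F_q`,
i.e. `b ^ q = b`. -/
theorem stmt_1 (q : ℕ) (hq : IsPrimePow q)
    (F K : Type*) [Field F] [Fintype F] [Field K] [Fintype K] [Algebra F K]
    (hF : Fintype.card F = q) (hK : Fintype.card K = q ^ 2)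
    (r : K) (hr : r ∉ Set.range (algebraMap F K))
    (b : K) (hb : b ≠ 0)
    (hinj : Function.Injective fun x : F =>
      algebraMap F K x + b / (algebraMap F K x - r) + b ^ q / (algebraMap F K x - r ^ q)) :
    b ^ q = b := by
  subst hF
  have hconj (x : K) : (x ^ Fintype.card F) ^ Fintype.card F = x := by
    rw [← pow_mul, ← sq, ← hK, FiniteField.pow_card]
  have hrq : r ^ Fintype.card F ≠ r := fun h => hr (mem_range_algebraMap_of_pow_card_eq h)
  have hd : r ^ Fintype.card F - r ≠ 0 := sub_ne_zero.mpr hrq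
  have hvalues (x : F) : ∃ y : F, algebraMap F K y = algebraMap F K x +
      b / (algebraMap F K x - r) + b ^ Fintype.card F / (algebraMap F K x - r ^ Fintype.card F) := by
    apply mem_range_algebraMap_of_pow_card_eq
    have hσ (z : K) : z ^ Fintype.card F = FiniteField.frobeniusAlgHom F K z := rfl
    have hσσ (z : K) : FiniteField.frobeniusAlgHom F K (FiniteField.frobeniusAlgHom F K z) = z :=
      hconj z
    simp only [hσ, map_add, map_sub, map_div₀, hσσ, AlgHom.commutes]
    ring
  choose f hf using hvalues
  have hf_inj : Function.Injective f := fun x y hxy => hinj <| by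
    simp only [← hf, hxy]
  have hsum : ∑ x : F, algebraMap F K (f x) = ∑ x : F, algebraMap F K x :=
    (Finite.injective_iff_bijective.mp hf_inj).sum_comp (algebraMap F K)
  have hpole (c z : K) (hz : z ^ Fintype.card F ≠ z) :
      ∑ x : F, c / (algebraMap F K x - z) = c / (z ^ Fintype.card F - z) := by
    have h := congrArg (-c * ·) (sum_one_div_sub_algebraMap (F := F) hz)
    simp only [Finset.mul_sum] at h
    convert h using 1
    · refine Finset.sum_congr rfl fun x _ => ?_
      rw [← neg_sub z, div_neg]
      ring
    · ring
  simp only [hf, Finset.sum_add_distrib] at hsum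
  rw [hpole b r hrq, hpole _ (r ^ Fintype.card F) (by rw [hconj]; exact hrq.symm), hconj,
    ← neg_sub (r ^ Fintype.card F) r, div_neg, add_assoc, add_eq_left, ← sub_eq_add_neg,
    ← sub_div, div_eq_zero_iff, or_iff_left hd, sub_eq_zero] at hsum
  exact hsum.symm
end

section
/- Let q be an odd prime power, let a ∈ F_q with a ≠ 0, and let r ∈ F_{q^2} with r ∉ F_q and r^2 ∈ F_q. The map from F_q to F_{q^2} sending x to ax + 1/(x − r) + 1/(x + r) is injective if and only if 4·a·r^2 = −1 (i.e., a = −1/(4r^2)). -/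
section InverseSums

variable {F K : Type*} [Field F] [Field K] [Algebra F K]

theorem algebraMap_sub_ne_zero_of_notMem_range {r : K} (hr : r ∉ Set.range (algebraMap F K))
    (x : F) : algebraMap F K x - r ≠ 0 :=
  fun h => hr ⟨x, sub_eq_zero.mp h⟩

theorem algebraMap_add_ne_zero_of_notMem_range {r : K} (hr : r ∉ Set.range (algebraMap F K))
    (x : F) : algebraMap F K x + r ≠ 0 :=
  fun h => hr ⟨-x, by rw [map_neg]; exact neg_eq_of_add_eq_zero_right h⟩

variable [Fintype F]

/-- The cross terms `1 / ((x - r) (x + c - r))` with `c ≠ 0` telescope. -/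
theorem sum_inv_sub_sq_eq_sq_sum {r : K} (hr : r ∉ Set.range (algebraMap F K)) :
    ∑ x : F, (algebraMap F K x - r)⁻¹ ^ 2 = (∑ x : F, (algebraMap F K x - r)⁻¹) ^ 2 := by
  symm
  have hshift : ∀ c : F, ∑ x : F, (algebraMap F K (x + c) - r)⁻¹
      = ∑ x : F, (algebraMap F K x - r)⁻¹ := fun c =>
    Fintype.sum_equiv (Equiv.addRight c) _ _ fun x => rfl
  calc (∑ x : F, (algebraMap F K x - r)⁻¹) ^ 2
      = ∑ x : F, ∑ c : F, (algebraMap F K x - r)⁻¹ * (algebraMap F K (x + c) - r)⁻¹ := by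
        rw [sq, Finset.sum_mul_sum]
        refine Finset.sum_congr rfl fun x _ => ?_
        exact (Fintype.sum_equiv (Equiv.addLeft x) _ _ fun c => rfl).symm
    _ = ∑ c : F, ∑ x : F, (algebraMap F K x - r)⁻¹ * (algebraMap F K (x + c) - r)⁻¹ :=
        Finset.sum_comm
    _ = ∑ x : F, (algebraMap F K x - r)⁻¹ ^ 2 := by
        rw [Finset.sum_eq_single (0 : F)]
        · simp [sq]
        · intro c _ hc
          have hc' : algebraMap F K c ≠ 0 := by simpa using hc
          have hterm : ∀ x : F, (algebraMap F K x - r)⁻¹ * (algebraMap F K (x + c) - r)⁻¹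
              = (algebraMap F K c)⁻¹ *
                ((algebraMap F K x - r)⁻¹ - (algebraMap F K (x + c) - r)⁻¹) := by
            intro x
            have h1 := algebraMap_sub_ne_zero_of_notMem_range hr x
            have h2 := algebraMap_sub_ne_zero_of_notMem_range hr (x + c)
            rw [inv_sub_inv h1 h2, map_add]
            rw [map_add] at h2
            field_simp
            ring
          simp_rw [hterm]
          rw [← Finset.mul_sum, Finset.sum_sub_distrib, hshift, sub_self, mul_zero]
        · simp

theorem sum_inv_add_eq_neg_sum_inv_sub (r : K) :
    ∑ x : F, (algebraMap F K x + r)⁻¹ = -∑ x : F, (algebraMap F K x - r)⁻¹ := by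
  rw [← Finset.sum_neg_distrib]
  refine Fintype.sum_equiv (Equiv.neg F) _ _ fun x => ?_
  rw [Equiv.neg_apply, map_neg, ← inv_neg]
  ring_nf

theorem sum_inv_add_sq_eq_sum_inv_sub_sq (r : K) :
    ∑ x : F, (algebraMap F K x + r)⁻¹ ^ 2 = ∑ x : F, (algebraMap F K x - r)⁻¹ ^ 2 := by
  refine Fintype.sum_equiv (Equiv.neg F) _ _ fun x => ?_
  rw [Equiv.neg_apply, map_neg, ← neg_sq, ← inv_neg]
  ring_nf

theorem sum_const_eq_zero_of_algebra (c : K) : ∑ _x : F, c = 0 := by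
  have h : ((Fintype.card F : F) : F) = 0 := FiniteField.cast_card_eq_zero F
  have h' : (Fintype.card F : K) = 0 := by
    rw [← map_natCast (algebraMap F K), h, map_zero]
  rw [Finset.sum_const, Finset.card_univ, nsmul_eq_mul, h', zero_mul]

/-- The sum is evaluated by means of the involution `x ↦ r ^ 2 / x`. -/
theorem two_mul_sum_inv_sub {r : K} (hr : r ∉ Set.range (algebraMap F K))
    (hr2 : r ^ 2 ∈ Set.range (algebraMap F K)) :
    2 * r * ∑ x : F, (algebraMap F K x - r)⁻¹ = -1 := by
  classical
  obtain ⟨d, hd⟩ := hr2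
  have hr0 : r ≠ 0 := fun h => hr ⟨0, by rw [h, map_zero]⟩
  have hd0 : d ≠ 0 := by
    rintro rfl
    rw [map_zero] at hd
    exact hr0 (pow_eq_zero_iff two_ne_zero |>.mp hd.symm)
  have hinv : Function.Involutive fun x : F => d * x⁻¹ := fun x => by
    change d * (d * x⁻¹)⁻¹ = x
    rw [mul_inv, inv_inv, mul_inv_cancel_left₀ hd0]
  have hterm : ∀ x : F, (algebraMap F K (d * x⁻¹) - r)⁻¹
      = (-r⁻¹ - (algebraMap F K x - r)⁻¹) + if x = 0 then -r⁻¹ else 0 := by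
    intro x
    split_ifs with hx
    · simp [hx, inv_neg]
    · have hx' : algebraMap F K x ≠ 0 := by simpa using hx
      have h1 := algebraMap_sub_ne_zero_of_notMem_range hr x
      have h2 := algebraMap_sub_ne_zero_of_notMem_range hr (d * x⁻¹)
      rw [add_zero]
      refine inv_eq_of_mul_eq_one_right ?_
      rw [map_mul, map_inv₀, hd]
      field_simp
      ring
  have hsum : ∑ x : F, (algebraMap F K x - r)⁻¹
      = -(∑ x : F, (algebraMap F K x - r)⁻¹) - r⁻¹ := by
    calc ∑ x : F, (algebraMap F K x - r)⁻¹
        = ∑ x : F, (algebraMap F K (d * x⁻¹) - r)⁻¹ :=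
          (Equiv.sum_comp hinv.toPerm fun x => (algebraMap F K x - r)⁻¹).symm
      _ = -(∑ x : F, (algebraMap F K x - r)⁻¹) - r⁻¹ := by
          simp_rw [hterm]
          rw [Finset.sum_add_distrib, Finset.sum_sub_distrib, sum_const_eq_zero_of_algebra,
            Finset.sum_ite_eq' Finset.univ (0 : F) fun _ => -r⁻¹]
          simp [sub_eq_add_neg]
  have hrr : r * r⁻¹ = 1 := mul_inv_cancel₀ hr0
  linear_combination r * hsum - hrr

/-- The second power sum of `x ↦ a x + 1 / (x - r) + 1 / (x + r)` over a finite field. -/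
theorem two_mul_sq_mul_sum_sq {r : K} (hr : r ∉ Set.range (algebraMap F K))
    (hr2 : r ^ 2 ∈ Set.range (algebraMap F K)) (a : F) :
    2 * r ^ 2 * ∑ x : F, (algebraMap F K (a * x) + (algebraMap F K x - r)⁻¹
        + (algebraMap F K x + r)⁻¹) ^ 2
      = 2 * r ^ 2 * ∑ x : F, algebraMap F K (a * x) ^ 2
        - (4 * algebraMap F K a * r ^ 2 + 1) := by
  have hr0 : r ≠ 0 := fun h => hr ⟨0, by rw [h, map_zero]⟩
  set S := ∑ x : F, (algebraMap F K x - r)⁻¹ with hS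
  have hrS : 2 * r * S = -1 := two_mul_sum_inv_sub hr hr2
  have hterm : ∀ x : F, (algebraMap F K (a * x) + (algebraMap F K x - r)⁻¹
        + (algebraMap F K x + r)⁻¹) ^ 2
      = algebraMap F K (a * x) ^ 2 + 4 * algebraMap F K a
        + (2 * algebraMap F K a * r + r⁻¹)
          * ((algebraMap F K x - r)⁻¹ - (algebraMap F K x + r)⁻¹)
        + ((algebraMap F K x - r)⁻¹ ^ 2 + (algebraMap F K x + r)⁻¹ ^ 2) := by
    intro x
    have h3 := algebraMap_sub_ne_zero_of_notMem_range hr x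
    have h4 := algebraMap_add_ne_zero_of_notMem_range hr x
    rw [map_mul]
    field_simp
    ring
  simp_rw [hterm]
  rw [Finset.sum_add_distrib, Finset.sum_add_distrib, Finset.sum_add_distrib,
    Finset.sum_add_distrib, sum_const_eq_zero_of_algebra, ← Finset.mul_sum,
    Finset.sum_sub_distrib, sum_inv_add_eq_neg_sum_inv_sub,
    sum_inv_add_sq_eq_sum_inv_sub_sq, sum_inv_sub_sq_eq_sq_sum hr, ← hS]
  have hrr : r * r⁻¹ = 1 := mul_inv_cancel₀ hr0
  linear_combination (4 * algebraMap F K a * r ^ 2 + 2 * r * S + 1) * hrS + 4 * r * S * hrr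

end InverseSums

/-- For `q` odd, `a ∈ F_q*`, `r ∈ F_{q²} \ F_q` with `r² ∈ F_q`, the map
`x ↦ a·x + 1/(x - r) + 1/(x + r)` is injective on `F_q` iff `4·a·r² = -1`. -/
theorem stmt_3 (q : ℕ) (hq : IsPrimePow q) (hodd : Odd q)
    (F K : Type*) [Field F] [Fintype F] [Field K] [Fintype K] [Algebra F K]
    (hF : Fintype.card F = q) (hK : Fintype.card K = q ^ 2)
    (a : F) (ha : a ≠ 0)
    (r : K) (hr : r ∉ Set.range (algebraMap F K))
    (hr2 : r ^ 2 ∈ Set.range (algebraMap F K)) :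
    (Function.Injective fun x : F =>
      algebraMap F K (a * x) + (algebraMap F K x - r)⁻¹ + (algebraMap F K x + r)⁻¹)
    ↔ 4 * algebraMap F K a * r ^ 2 = -1 := by
  constructor
  · intro hinj
    obtain ⟨d, hd⟩ := hr2
    have hval : ∀ x : F, algebraMap F K (a * x) + (algebraMap F K x - r)⁻¹
        + (algebraMap F K x + r)⁻¹ = algebraMap F K (a * x + 2 * x / (x ^ 2 - d)) := by
      intro x
      have h3 := algebraMap_sub_ne_zero_of_notMem_range hr x
      have h4 := algebraMap_add_ne_zero_of_notMem_range hr x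
      have h5 : algebraMap F K x ^ 2 - r ^ 2
          = (algebraMap F K x - r) * (algebraMap F K x + r) := by ring
      rw [map_add, map_div₀, map_sub, map_pow, hd, h5, map_mul _ 2, map_ofNat]
      field_simp
      ring
    have hbij : Function.Bijective fun x : F => a * x + 2 * x / (x ^ 2 - d) := by
      refine Finite.injective_iff_bijective.mp fun x y hxy => hinj ?_
      simp only [hval]
      exact congrArg _ hxy
    have hsum : ∑ x : F, (algebraMap F K (a * x) + (algebraMap F K x - r)⁻¹
        + (algebraMap F K x + r)⁻¹) ^ 2 = ∑ x : F, algebraMap F K (a * x) ^ 2 := by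
      simp_rw [hval]
      exact (hbij.sum_comp fun y => algebraMap F K y ^ 2).trans
        ((mulLeft_bijective₀ a ha).sum_comp fun y => algebraMap F K y ^ 2).symm
    have key := two_mul_sq_mul_sum_sq hr ⟨d, hd⟩ a
    rw [hsum] at key
    linear_combination key
  · intro h x y hxy
    by_contra hne
    have hne' : algebraMap F K x - algebraMap F K y ≠ 0 :=
      sub_ne_zero.mpr fun he => hne ((algebraMap F K).injective he)
    obtain ⟨d, hd⟩ := hr2
    have hx1 := algebraMap_sub_ne_zero_of_notMem_range hr x
    have hx2 := algebraMap_add_ne_zero_of_notMem_range hr x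
    have hy1 := algebraMap_sub_ne_zero_of_notMem_range hr y
    have hy2 := algebraMap_add_ne_zero_of_notMem_range hr y
    simp only [map_mul] at hxy
    set X := algebraMap F K x
    set Y := algebraMap F K y
    set A := algebraMap F K a
    have hprod : (X - Y) * (A * (X ^ 2 - r ^ 2) * (Y ^ 2 - r ^ 2) - 2 * (X * Y + r ^ 2)) = 0 := by
      field_simp at hxy
      linear_combination hxy
    have hconic := (mul_eq_zero.mp hprod).resolve_left hne'
    have hsq : (r * (X - Y)) ^ 2 = (X * Y + 3 * r ^ 2) ^ 2 := by
      linear_combination 4 * r ^ 2 * hconic - (X ^ 2 - r ^ 2) * (Y ^ 2 - r ^ 2) * h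
    have hmem : ∀ z : F, r * (X - Y) = algebraMap F K z → False := fun z hz =>
      hr ⟨z / (x - y), by rw [map_div₀, map_sub, ← hz, mul_div_assoc, div_self hne', mul_one]⟩
    rcases sq_eq_sq_iff_eq_or_eq_neg.mp hsq with h' | h'
    · exact hmem (x * y + 3 * d) (by rw [h', map_add, map_mul, map_mul, map_ofNat, hd])
    · exact hmem (-(x * y + 3 * d))
        (by rw [h', map_neg, map_add, map_mul, map_mul, map_ofNat, hd])
end

section
/- Let q be a prime power with q > 7 whose characteristic is neither 2 nor 3, let a ∈ F_q with a ≠ 0, let b ∈ F_q, and let r ∈ F_{q^2} with r ∉ F_q and r^2 ∈ F_q. Then the map from F_q to F_{q^2} sending x to a·x^2 + b·x + 1/(x − r) + 1/(x + r) is not injective. -/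
open Polynomial in
/-- Over `F_q`, the sum of the values of a polynomial of degree at most `q - 1` is the negative of
its coefficient of degree `q - 1`. -/
theorem sum_eval_algebraMap_eq_neg_coeff {F K : Type*} [Field F] [Fintype F] [Field K] [Algebra F K]
    (P : K[X]) (hP : P.natDegree ≤ Fintype.card F - 1) :
    ∑ x : F, P.eval (algebraMap F K x) = -P.coeff (Fintype.card F - 1) := by
  classical
  have hlt : P.natDegree < Fintype.card F - 1 + 1 := by omega
  simp_rw [eval_eq_sum_range' hlt]
  rw [Finset.sum_comm, Finset.sum_range_succ, Finset.sum_eq_zero]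
  · have h : ∑ x : F, x ^ (Fintype.card F - 1) = -1 := by
      have hpos : Fintype.card F - 1 ≠ 0 := by
        have := Fintype.one_lt_card (α := F)
        omega
      rw [← Finset.add_sum_erase _ _ (Finset.mem_univ (0 : F)), zero_pow hpos, zero_add,
        Finset.sum_congr rfl fun x hx =>
          FiniteField.pow_card_sub_one_eq_one x (Finset.ne_of_mem_erase hx)]
      simp [Finset.card_erase_of_mem, Nat.cast_sub Fintype.card_pos]
    simp_rw [← Finset.mul_sum, ← map_pow, ← map_sum, h]
    simp
  · intro i hi
    simp_rw [← Finset.mul_sum, ← map_pow, ← map_sum,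
      FiniteField.sum_pow_lt_card_sub_one F i (Finset.mem_range.mp hi)]
    simp

open Polynomial in
/-- If `r ^ q = -r ≠ 0`, the powers of `(x + r) / (x - r)` with exponent at most `q` sum to `-1`
over `F_q`. -/
theorem sum_add_div_sub_pow {F K : Type*} [Field F] [Fintype F] [Field K] [Algebra F K]
    {r : K} (hr : r ^ Fintype.card F = -r) (hne : ∀ x : F, algebraMap F K x - r ≠ 0)
    {j : ℕ} (hj0 : 0 < j) (hj : j ≤ Fintype.card F) :
    ∑ x : F, ((algebraMap F K x + r) / (algebraMap F K x - r)) ^ j = -1 := by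
  have hmonic : ((X + C r) ^ (j - 1) * (X - C r) ^ (Fintype.card F - j) : K[X]).Monic :=
    ((monic_X_add_C r).pow _).mul ((monic_X_sub_C r).pow _)
  have hdeg : ((X + C r) ^ (j - 1) * (X - C r) ^ (Fintype.card F - j) : K[X]).natDegree
      = Fintype.card F - 1 := by
    rw [((monic_X_add_C r).pow _).natDegree_mul ((monic_X_sub_C r).pow _)]
    simp only [natDegree_pow, natDegree_X_add_C, natDegree_X_sub_C]
    omega
  have h := sum_eval_algebraMap_eq_neg_coeff (F := F) _ hdeg.le
  rw [← hdeg, hmonic.coeff_natDegree] at h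
  rw [← h]
  refine Finset.sum_congr rfl fun x _ => ?_
  have hfrob : (algebraMap F K x - r) ^ Fintype.card F = algebraMap F K x + r := by
    have := map_sub (FiniteField.frobeniusAlgHom F K) (algebraMap F K x) r
    simpa [hr, ← map_pow, FiniteField.pow_card] using this
  simp only [eval_mul, eval_pow, eval_add, eval_sub, eval_X, eval_C]
  rw [div_pow, div_eq_iff (pow_ne_zero _ (hne x)), mul_assoc, ← pow_add, Nat.sub_add_cancel hj,
    hfrob, ← pow_succ, Nat.sub_add_cancel hj0]

/-- If `r ^ q = -r ≠ 0`, the power sums of `1 / (x - r)` over `F_q` of exponents `1, 2, 3` are the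
powers of `-1 / (2 * r)`. -/
theorem sum_inv_sub_pow {F K : Type*} [Field F] [Fintype F] [Field K] [Algebra F K]
    {r : K} (hr : r ^ Fintype.card F = -r) (hne : ∀ x : F, algebraMap F K x - r ≠ 0)
    (h2 : (2 : K) ≠ 0) (hcard : 3 ≤ Fintype.card F) :
    ∑ x : F, (algebraMap F K x - r)⁻¹ = -(2 * r)⁻¹ ∧
    ∑ x : F, (algebraMap F K x - r)⁻¹ ^ 2 = (2 * r)⁻¹ ^ 2 ∧
    ∑ x : F, (algebraMap F K x - r)⁻¹ ^ 3 = -(2 * r)⁻¹ ^ 3 := by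
  have hr0 : r ≠ 0 := by simpa using hne 0
  have hu (x : F) : (algebraMap F K x - r)⁻¹
      = (2 * r)⁻¹ * ((algebraMap F K x + r) / (algebraMap F K x - r) - 1) := by
    have := hne x
    field_simp
    ring
  have s1 := sum_add_div_sub_pow hr hne (j := 1) (by omega) (by omega)
  have s2 := sum_add_div_sub_pow hr hne (j := 2) (by omega) (by omega)
  have s3 := sum_add_div_sub_pow hr hne (j := 3) (by omega) (by omega)
  have s0 : ∑ _x : F, (1 : K) = 0 := by
    have h := congrArg (algebraMap F K) (FiniteField.cast_card_eq_zero F)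
    rw [map_natCast, map_zero] at h
    simpa using h
  simp only [pow_one] at s1
  refine ⟨?_, ?_, ?_⟩
  · simp_rw [hu, ← Finset.mul_sum, Finset.sum_sub_distrib, s1, s0]
    ring
  · have h (y : K) : ((2 * r)⁻¹ * (y - 1)) ^ 2 = (2 * r)⁻¹ ^ 2 * (y ^ 2 - 2 * y + 1) := by ring
    simp_rw [hu, h, ← Finset.mul_sum, Finset.sum_add_distrib, Finset.sum_sub_distrib,
      ← Finset.mul_sum, s1, s2, s0]
    ring
  · have h (y : K) : ((2 * r)⁻¹ * (y - 1)) ^ 3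
        = (2 * r)⁻¹ ^ 3 * (y ^ 3 - 3 * y ^ 2 + 3 * y - 1) := by ring
    simp_rw [hu, h, ← Finset.mul_sum, Finset.sum_sub_distrib, Finset.sum_add_distrib,
      Finset.sum_sub_distrib, ← Finset.mul_sum, s1, s2, s3, s0]
    ring

/-- A square root, outside `F_q`, of an element of `F_q` is negated by the Frobenius map. -/
theorem pow_card_eq_neg_of_sq_mem_range {F K : Type*} [Field F] [Fintype F] [Field K] [Algebra F K]
    (hchar2 : ringChar F ≠ 2) {r : K} (hr : r ∉ Set.range (algebraMap F K))
    (hr2 : r ^ 2 ∈ Set.range (algebraMap F K)) : r ^ Fintype.card F = -r := by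
  obtain ⟨d, hd⟩ := hr2
  have hd0 : d ≠ 0 := by
    rintro rfl
    have : r = 0 := by simpa using hd.symm
    exact hr ⟨0, by simp [this]⟩
  have hnsq : ¬ IsSquare d := by
    rintro ⟨e, rfl⟩
    rw [map_mul, ← sq, sq_eq_sq_iff_eq_or_eq_neg] at hd
    rcases hd with h | h
    · exact hr ⟨e, h⟩
    · exact hr ⟨-e, by rw [map_neg, h, neg_neg]⟩
  have hpow := (FiniteField.pow_dichotomy hchar2 hd0).resolve_left
    fun h => hnsq ((FiniteField.isSquare_iff hchar2 hd0).mpr h)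
  have hodd := FiniteField.odd_card_of_char_ne_two hchar2
  have hq : Fintype.card F = 2 * (Fintype.card F / 2) + 1 := by omega
  rw [hq, pow_succ, pow_mul, ← hd, ← map_pow, hpow]
  simp

/-- For `q > 7` of characteristic `≠ 2, 3`, `a ∈ F_q*`, `b ∈ F_q`,
`r ∈ F_{q²} \ F_q` with `r² ∈ F_q`, the map
`x ↦ a·x² + b·x + 1/(x - r) + 1/(x + r)` is not injective on `F_q`. -/
theorem stmt_5 (q : ℕ) (hq : IsPrimePow q) (hq7 : 7 < q)
    (F K : Type*) [Field F] [Fintype F] [Field K] [Fintype K] [Algebra F K]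
    (hF : Fintype.card F = q) (hK : Fintype.card K = q ^ 2)
    (hchar2 : ringChar F ≠ 2) (hchar3 : ringChar F ≠ 3)
    (a : F) (ha : a ≠ 0) (b : F)
    (r : K) (hr : r ∉ Set.range (algebraMap F K))
    (hr2 : r ^ 2 ∈ Set.range (algebraMap F K)) :
    ¬ Function.Injective fun x : F =>
      algebraMap F K (a * x ^ 2 + b * x) + (algebraMap F K x - r)⁻¹
        + (algebraMap F K x + r)⁻¹ := by
  intro hinj
  have h2F : (2 : F) ≠ 0 := Ring.two_ne_zero hchar2
  have h3F : (3 : F) ≠ 0 := by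
    intro h
    have hdvd : ringChar F ∣ 3 := (ringChar.spec F 3).mp (by exact_mod_cast h)
    rcases (Nat.dvd_prime Nat.prime_three).mp hdvd with h1 | h1
    · exact CharP.ringChar_ne_one h1
    · exact hchar3 h1
  have h2 : (2 : K) ≠ 0 := map_ofNat (algebraMap F K) 2 ▸ (map_ne_zero _).mpr h2F
  have h3 : (3 : K) ≠ 0 := map_ofNat (algebraMap F K) 3 ▸ (map_ne_zero _).mpr h3F
  have hcard : 8 < Fintype.card F := by
    have := FiniteField.odd_card_of_char_ne_two hchar2
    omega
  have hA : algebraMap F K a ≠ 0 := (map_ne_zero _).mpr ha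
  have hfrob := pow_card_eq_neg_of_sq_mem_range hchar2 hr hr2
  have hsub (x : F) : algebraMap F K x - r ≠ 0 := fun h => hr ⟨x, sub_eq_zero.mp h⟩
  have hadd (x : F) : algebraMap F K x + r ≠ 0 := fun h =>
    hr ⟨-x, by rw [map_neg, eq_neg_of_add_eq_zero_left h, neg_neg]⟩
  have hr0 : r ≠ 0 := by simpa using hsub 0
  obtain ⟨u1, u2, u3⟩ := sum_inv_sub_pow hfrob hsub h2 (by omega)
  have hfrob' : (-r) ^ Fintype.card F = -(-r) := by
    have := map_neg (FiniteField.frobeniusAlgHom F K) r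
    simpa [hfrob] using this
  obtain ⟨v1, v2, v3⟩ := sum_inv_sub_pow (r := -r) hfrob' (by simpa using hadd) h2 (by omega)
  simp only [sub_neg_eq_add] at v1 v2 v3
  obtain ⟨d, hd⟩ := hr2
  have hgf (x : F) : algebraMap F K (a * x ^ 2 + b * x + 2 * x / (x ^ 2 - d)) =
      algebraMap F K (a * x ^ 2 + b * x) + (algebraMap F K x - r)⁻¹
        + (algebraMap F K x + r)⁻¹ := by
    have h : algebraMap F K x ^ 2 - r ^ 2 ≠ 0 := by
      rw [sq_sub_sq]
      exact mul_ne_zero (hadd x) (hsub x)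
    have := hsub x
    have := hadd x
    rw [map_add _ _ (_ / _), map_div₀, map_sub, map_mul _ 2, map_ofNat, map_pow, hd, add_assoc]
    congr 1
    field_simp
    ring
  simp_rw [← hgf] at hinj
  have hbij := Finite.injective_iff_bijective.mp hinj.of_comp
  have hpow (k : ℕ) (hk : k < Fintype.card F - 1) :
      ∑ x : F, (algebraMap F K (a * x ^ 2 + b * x) + (algebraMap F K x - r)⁻¹
        + (algebraMap F K x + r)⁻¹) ^ k = 0 := by
    simp_rw [← hgf, ← map_pow, ← map_sum]
    rw [hbij.sum_comp fun y => y ^ k, FiniteField.sum_pow_lt_card_sub_one F k hk, map_zero]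
  have hpoly (P : Polynomial K) (hP : P.natDegree ≤ 6) :
      ∑ x : F, P.eval (algebraMap F K x) = 0 := by
    rw [sum_eval_algebraMap_eq_neg_coeff P (by omega),
      Polynomial.coeff_eq_zero_of_natDegree_lt (by omega), neg_zero]
  have e2 := hpow 2 (by omega)
  have e3 := hpow 3 (by omega)
  simp only [map_add, map_mul, map_pow] at e2 e3
  generalize algebraMap F K a = A at *
  generalize algebraMap F K b = B at *
  have id2 (x : F) : (A * algebraMap F K x ^ 2 + B * algebraMap F K x
      + (algebraMap F K x - r)⁻¹ + (algebraMap F K x + r)⁻¹) ^ 2 =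
      Polynomial.eval (algebraMap F K x)
        ((.C A * .X ^ 2 + .C B * .X) ^ 2 + 4 * (.C A * .X + .C B))
      + (algebraMap F K x - r)⁻¹ ^ 2 + (algebraMap F K x + r)⁻¹ ^ 2
      + 2 * ((2 * r)⁻¹ + A * r ^ 2 + B * r) * (algebraMap F K x - r)⁻¹
      + 2 * (-(2 * r)⁻¹ + A * r ^ 2 - B * r) * (algebraMap F K x + r)⁻¹ := by
    have := hsub x
    have := hadd x
    simp only [Polynomial.eval_add, Polynomial.eval_mul, Polynomial.eval_pow, Polynomial.eval_C,
      Polynomial.eval_X, Polynomial.eval_ofNat]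
    field_simp
    ring
  have id3 (x : F) : (A * algebraMap F K x ^ 2 + B * algebraMap F K x
      + (algebraMap F K x - r)⁻¹ + (algebraMap F K x + r)⁻¹) ^ 3 =
      Polynomial.eval (algebraMap F K x)
        ((.C A * .X ^ 2 + .C B * .X) ^ 3
          + 6 * (.C A * .X ^ 2 + .C B * .X) * (.C A * .X + .C B)
          + .C (3 * (A * r ^ 2 + B * r)) * (.C A * .X + .C (A * r + B))
          + .C (3 * (A * r ^ 2 - B * r)) * (.C A * .X + .C (-A * r + B)) + .C (12 * A))
      + (algebraMap F K x - r)⁻¹ ^ 3 + (algebraMap F K x + r)⁻¹ ^ 3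
      + 3 * ((2 * r)⁻¹ + A * r ^ 2 + B * r) * (algebraMap F K x - r)⁻¹ ^ 2
      + 3 * (-(2 * r)⁻¹ + A * r ^ 2 - B * r) * (algebraMap F K x + r)⁻¹ ^ 2
      + 3 * (-(2 * r)⁻¹ ^ 2 + 2 * A * r + B + ((2 * r)⁻¹ + A * r ^ 2 + B * r) ^ 2)
        * (algebraMap F K x - r)⁻¹
      + 3 * (-(2 * r)⁻¹ ^ 2 - 2 * A * r + B + (-(2 * r)⁻¹ + A * r ^ 2 - B * r) ^ 2)
        * (algebraMap F K x + r)⁻¹ := by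
    have := hsub x
    have := hadd x
    simp only [Polynomial.eval_add, Polynomial.eval_mul, Polynomial.eval_pow, Polynomial.eval_C,
      Polynomial.eval_X, Polynomial.eval_ofNat]
    field_simp
    ring
  simp_rw [id2, Finset.sum_add_distrib, ← Finset.mul_sum, u1, u2, v1, v2] at e2
  rw [hpoly _ (by compute_degree!)] at e2
  simp_rw [id3, Finset.sum_add_distrib, ← Finset.mul_sum, u1, u2, u3, v1, v2, v3] at e3
  rw [hpoly _ (by compute_degree!)] at e3
  have hs : 2 * r * (2 * r)⁻¹ = 1 := mul_inv_cancel₀ (mul_ne_zero h2 hr0)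
  have hneg : (2 * -r)⁻¹ = -(2 * r)⁻¹ := by rw [mul_neg, inv_neg]
  rw [hneg] at e2 e3
  generalize (2 * r)⁻¹ = s at *
  have hB : B = -s ^ 2 := mul_left_cancel₀ h2 (by linear_combination -e2 - 2 * B * hs)
  have h : 2 * 3 * A = 0 := by
    subst hB
    linear_combination -e3 + (6 * A * r ^ 2 * s ^ 2 - 6 * A) * hs
  exact mul_ne_zero (mul_ne_zero h2 h3) hA h
end

section
/- Let q ≥ 5 be a prime power whose characteristic is not 3, let a ∈ F_q with a ≠ 0, and let r ∈ F_{q^3} with r ∉ F_q. Then the map from F_q to F_{q^3} sending x to a·x + 1/(x − r) + 1/(x − r^q) + 1/(x − r^{q^2}) is not injective. -/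
section PowerSums

variable {F K : Type*} [Field F] [Fintype F] [Field K] [Algebra F K]

theorem sum_algebraMap_sub_pow_eq_zero (z : K) {j : ℕ} (hj : j < Fintype.card F - 1) :
    ∑ x : F, (algebraMap F K x - z) ^ j = 0 := by
  simp_rw [sub_eq_add_neg, add_pow]
  rw [Finset.sum_comm]
  refine Finset.sum_eq_zero fun i hi => ?_
  rw [← Finset.sum_mul, ← Finset.sum_mul]
  simp_rw [← map_pow]
  rw [← map_sum, FiniteField.sum_pow_lt_card_sub_one F i
    (by have := Finset.mem_range.mp hi; omega)]
  simp

theorem sum_algebraMap_sub_pow_card_sub_one (z : K) :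
    ∑ x : F, (algebraMap F K x - z) ^ (Fintype.card F - 1) = -1 := by
  classical
  simp_rw [sub_eq_add_neg, add_pow]
  rw [Finset.sum_comm, Finset.sum_range_succ, Finset.sum_eq_zero fun i hi => ?_]
  · simp only [Nat.sub_self, pow_zero, mul_one, Nat.choose_self, Nat.cast_one, zero_add]
    simp_rw [← map_pow]
    rw [← map_sum, ← Finset.sum_erase_add _ _ (Finset.mem_univ (0 : F)),
      zero_pow (Nat.sub_ne_zero_of_lt Fintype.one_lt_card),
      Finset.sum_congr rfl fun x hx =>
        FiniteField.pow_card_sub_one_eq_one x (Finset.ne_of_mem_erase hx)]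
    simp [Finset.card_erase_of_mem, Nat.cast_sub Fintype.card_pos]
  · rw [← Finset.sum_mul, ← Finset.sum_mul]
    simp_rw [← map_pow]
    rw [← map_sum, FiniteField.sum_pow_lt_card_sub_one F i (Finset.mem_range.mp hi)]
    simp

theorem sub_mul_inv_pow_succ {z : K} (hz : z ∉ Set.range (algebraMap F K)) (x : F) {k : ℕ}
    (hk : k < Fintype.card F) :
    (z ^ Fintype.card F - z) * (algebraMap F K x - z)⁻¹ ^ (k + 1) =
      (algebraMap F K x - z)⁻¹ ^ k - (algebraMap F K x - z) ^ (Fintype.card F - 1 - k) := by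
  have hu : algebraMap F K x - z ≠ 0 := fun h => hz ⟨x, sub_eq_zero.mp h⟩
  have hfrob : (algebraMap F K x - z) ^ Fintype.card F =
      algebraMap F K x - z ^ Fintype.card F := by
    have := map_sub (FiniteField.frobeniusAlgHom F K) (algebraMap F K x) z
    rwa [AlgHom.commutes, FiniteField.coe_frobeniusAlgHom] at this
  have hpow : (algebraMap F K x - z) ^ (Fintype.card F - 1 - k) *
      (algebraMap F K x - z) ^ (k + 1) = (algebraMap F K x - z) ^ Fintype.card F := by
    rw [← pow_add]; congr 1; omega
  rw [hfrob] at hpow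
  have hinv : (algebraMap F K x - z)⁻¹ ^ k * (algebraMap F K x - z) ^ (k + 1) =
      algebraMap F K x - z := by
    rw [pow_succ, ← mul_assoc, ← mul_pow, inv_mul_cancel₀ hu, one_pow, one_mul]
  refine mul_right_cancel₀ (pow_ne_zero (k + 1) hu) ?_
  rw [mul_assoc, ← mul_pow, inv_mul_cancel₀ hu, one_pow, mul_one, sub_mul _ _ (_ ^ (k + 1)), hpow,
    hinv]
  ring

theorem sub_mul_sum_inv {z : K} (hz : z ∉ Set.range (algebraMap F K)) :
    (z ^ Fintype.card F - z) * ∑ x : F, (algebraMap F K x - z)⁻¹ = 1 := by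
  have hsum : ∑ x : F, (z ^ Fintype.card F - z) * (algebraMap F K x - z)⁻¹ ^ (0 + 1) =
      ∑ x : F, ((algebraMap F K x - z)⁻¹ ^ 0 -
        (algebraMap F K x - z) ^ (Fintype.card F - 1 - 0)) :=
    Finset.sum_congr rfl fun x _ => sub_mul_inv_pow_succ hz x Fintype.card_pos
  have hcard : ((Fintype.card F : ℕ) : K) = 0 := by
    rw [← map_natCast (algebraMap F K), FiniteField.cast_card_eq_zero, map_zero]
  simpa [← Finset.mul_sum, sum_algebraMap_sub_pow_card_sub_one, hcard] using hsum

theorem pow_card_sub_ne_zero {z : K} (hz : z ∉ Set.range (algebraMap F K)) :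
    z ^ Fintype.card F - z ≠ 0 :=
  left_ne_zero_of_mul_eq_one (sub_mul_sum_inv hz)

/-- Carlitz's formula for the power sums of `1 / (x - z)` over a finite field. -/
theorem sum_inv_pow_succ {z : K} (hz : z ∉ Set.range (algebraMap F K)) {k : ℕ}
    (hk : k < Fintype.card F) :
    ∑ x : F, (algebraMap F K x - z)⁻¹ ^ (k + 1) = (z ^ Fintype.card F - z)⁻¹ ^ (k + 1) := by
  induction k with
  | zero => simpa using eq_inv_of_mul_eq_one_right (sub_mul_sum_inv hz)
  | succ k ih =>
    have hsum : ∑ x : F, (z ^ Fintype.card F - z) * (algebraMap F K x - z)⁻¹ ^ (k + 1 + 1) =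
        ∑ x : F, ((algebraMap F K x - z)⁻¹ ^ (k + 1) -
          (algebraMap F K x - z) ^ (Fintype.card F - 1 - (k + 1))) :=
      Finset.sum_congr rfl fun x _ => sub_mul_inv_pow_succ hz x hk
    rw [← Finset.mul_sum, Finset.sum_sub_distrib, sum_algebraMap_sub_pow_eq_zero z (by omega),
      ih (by omega), sub_zero] at hsum
    rw [pow_succ _ (k + 1), ← hsum, mul_comm, inv_mul_cancel_left₀ (pow_card_sub_ne_zero hz)]

theorem sum_pow_eq_zero_of_injective {f : F → K} (hf : Function.Injective f)
    (hfix : ∀ x, f x ^ Fintype.card F = f x) {k : ℕ} (hk : k < Fintype.card F - 1) :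
    ∑ x, f x ^ k = 0 := by
  have hrange : ∀ x, ∃ y, algebraMap F K y = f x := fun x => by
    by_contra h
    exact pow_card_sub_ne_zero (F := F) (z := f x) h (sub_eq_zero.mpr (hfix x))
  choose g hg using hrange
  have hginj : Function.Injective g := fun x y hxy => hf (by rw [← hg, ← hg, hxy])
  have hgbij : Function.Bijective g := Finite.injective_iff_bijective.mp hginj
  simp_rw [← hg, ← map_pow]
  rw [← map_sum, hgbij.sum_comp (fun x => x ^ k), FiniteField.sum_pow_lt_card_sub_one F k hk,
    map_zero]

end PowerSums

section Algebra

variable {K : Type*} [Field K]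

theorem sq_conjugate_sum_expand {a x r₀ r₁ r₂ t₀ t₁ t₂ i₀ i₁ i₂ : K}
    (h₀ : x * t₀ = 1 + r₀ * t₀) (h₁ : x * t₁ = 1 + r₁ * t₁) (h₂ : x * t₂ = 1 + r₂ * t₂)
    (h₀₁ : t₀ * t₁ = i₀ * (t₁ - t₀)) (h₁₂ : t₁ * t₂ = i₁ * (t₂ - t₁))
    (h₂₀ : t₂ * t₀ = i₂ * (t₀ - t₂)) :
    (a * x + t₀ + t₁ + t₂) ^ 2 =
      a ^ 2 * x ^ 2 + 6 * a * x ^ 0 + 2 * a * (r₀ * t₀ + r₁ * t₁ + r₂ * t₂) +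
        (t₀ ^ 2 + t₁ ^ 2 + t₂ ^ 2) +
        2 * (i₀ * (t₁ - t₀) + i₁ * (t₂ - t₁) + i₂ * (t₀ - t₂)) := by
  linear_combination 2 * a * (h₀ + h₁ + h₂) + 2 * (h₀₁ + h₁₂ + h₂₀)

theorem cube_conjugate_sum_expand {a x r₀ r₁ r₂ t₀ t₁ t₂ i₀ i₁ i₂ : K} (two : (2 : K) = 0)
    (h₀ : x * t₀ = 1 + r₀ * t₀) (h₁ : x * t₁ = 1 + r₁ * t₁) (h₂ : x * t₂ = 1 + r₂ * t₂)
    (h₀₁ : t₀ * t₁ = i₀ * (t₁ - t₀)) (h₁₂ : t₁ * t₂ = i₁ * (t₂ - t₁))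
    (h₂₀ : t₂ * t₀ = i₂ * (t₀ - t₂)) :
    (a * x + t₀ + t₁ + t₂) ^ 3 =
      a ^ 3 * x ^ 3 + a ^ 2 * x ^ 1 + a ^ 2 * (r₀ + r₁ + r₂) * x ^ 0 +
        a ^ 2 * (r₀ ^ 2 * t₀ + r₁ ^ 2 * t₁ + r₂ ^ 2 * t₂) +
        a * (t₀ + t₁ + t₂ + (r₀ * t₀ ^ 2 + r₁ * t₁ ^ 2 + r₂ * t₂ ^ 2)) +
        (t₀ ^ 3 + t₁ ^ 3 + t₂ ^ 3) +
        (i₀ * (t₀ ^ 2 + t₁ ^ 2) + i₁ * (t₁ ^ 2 + t₂ ^ 2) + i₂ * (t₂ ^ 2 + t₀ ^ 2)) := by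
  grind

theorem two_eq_zero_of_sq_sum {a r₀ r₁ r₂ : K} (ha : a ≠ 0) (three : (3 : K) ≠ 0)
    (h₀ : r₁ - r₀ ≠ 0) (h₁ : r₂ - r₁ ≠ 0) (h₂ : r₀ - r₂ ≠ 0)
    (hsum : (r₁ - r₀)⁻¹ + (r₂ - r₁)⁻¹ + (r₀ - r₂)⁻¹ = 0)
    (hsq : 2 * a * (r₀ * (r₁ - r₀)⁻¹ + r₁ * (r₂ - r₁)⁻¹ + r₂ * (r₀ - r₂)⁻¹) +
        ((r₁ - r₀)⁻¹ ^ 2 + (r₂ - r₁)⁻¹ ^ 2 + (r₀ - r₂)⁻¹ ^ 2) +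
        2 * ((r₁ - r₀)⁻¹ * ((r₂ - r₁)⁻¹ - (r₁ - r₀)⁻¹) +
          (r₂ - r₁)⁻¹ * ((r₀ - r₂)⁻¹ - (r₂ - r₁)⁻¹) +
          (r₀ - r₂)⁻¹ * ((r₁ - r₀)⁻¹ - (r₀ - r₂)⁻¹)) = 0) :
    (2 : K) = 0 := by
  by_contra two
  obtain ⟨i, hi⟩ : ∃ i, i = (r₁ - r₀)⁻¹ := ⟨_, rfl⟩
  obtain ⟨j, hj⟩ : ∃ j, j = (r₂ - r₁)⁻¹ := ⟨_, rfl⟩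
  obtain ⟨k, hk⟩ : ∃ k, k = (r₀ - r₂)⁻¹ := ⟨_, rfl⟩
  have hi0 : i ≠ 0 := hi ▸ inv_ne_zero h₀
  have hiy : i * (r₁ - r₀) = 1 := by rw [hi, inv_mul_cancel₀ h₀]
  have hjy : j * (r₂ - r₁) = 1 := by rw [hj, inv_mul_cancel₀ h₁]
  have hky : k * (r₀ - r₂) = 1 := by rw [hk, inv_mul_cancel₀ h₂]
  rw [← hi, ← hj, ← hk] at hsq hsum
  have hrel : i ^ 2 + i * j + j ^ 2 = 0 := by grind
  have hlin : r₀ * i + r₁ * j + r₂ * k = 0 := by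
    refine (mul_eq_zero.mp ?_).resolve_left (mul_ne_zero two ha)
    grind
  have hij : i = j := by grind
  subst hij
  exact mul_ne_zero three (pow_ne_zero 2 hi0) (by linear_combination hrel)

theorem cube_sum_ne_zero {a r₀ r₁ r₂ : K} (two : (2 : K) = 0)
    (h₀ : r₁ - r₀ ≠ 0) (h₁ : r₂ - r₁ ≠ 0) (h₂ : r₀ - r₂ ≠ 0)
    (hsum : (r₁ - r₀)⁻¹ + (r₂ - r₁)⁻¹ + (r₀ - r₂)⁻¹ = 0) :
    a ^ 2 * (r₀ ^ 2 * (r₁ - r₀)⁻¹ + r₁ ^ 2 * (r₂ - r₁)⁻¹ + r₂ ^ 2 * (r₀ - r₂)⁻¹) +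
        a * ((r₁ - r₀)⁻¹ + (r₂ - r₁)⁻¹ + (r₀ - r₂)⁻¹ +
          (r₀ * (r₁ - r₀)⁻¹ ^ 2 + r₁ * (r₂ - r₁)⁻¹ ^ 2 + r₂ * (r₀ - r₂)⁻¹ ^ 2)) +
        ((r₁ - r₀)⁻¹ ^ 3 + (r₂ - r₁)⁻¹ ^ 3 + (r₀ - r₂)⁻¹ ^ 3) +
        ((r₁ - r₀)⁻¹ * ((r₁ - r₀)⁻¹ ^ 2 + (r₂ - r₁)⁻¹ ^ 2) +
          (r₂ - r₁)⁻¹ * ((r₂ - r₁)⁻¹ ^ 2 + (r₀ - r₂)⁻¹ ^ 2) +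
          (r₀ - r₂)⁻¹ * ((r₀ - r₂)⁻¹ ^ 2 + (r₁ - r₀)⁻¹ ^ 2)) ≠ 0 := by
  intro hcube
  obtain ⟨i, hi⟩ : ∃ i, i = (r₁ - r₀)⁻¹ := ⟨_, rfl⟩
  obtain ⟨j, hj⟩ : ∃ j, j = (r₂ - r₁)⁻¹ := ⟨_, rfl⟩
  obtain ⟨k, hk⟩ : ∃ k, k = (r₀ - r₂)⁻¹ := ⟨_, rfl⟩
  have hi0 : i ≠ 0 := hi ▸ inv_ne_zero h₀
  have hj0 : j ≠ 0 := hj ▸ inv_ne_zero h₁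
  have hiy : i * (r₁ - r₀) = 1 := by rw [hi, inv_mul_cancel₀ h₀]
  have hjy : j * (r₂ - r₁) = 1 := by rw [hj, inv_mul_cancel₀ h₁]
  have hky : k * (r₀ - r₂) = 1 := by rw [hk, inv_mul_cancel₀ h₂]
  rw [← hi, ← hj, ← hk] at hcube hsum
  have hrel : i ^ 2 + i * j + j ^ 2 = 0 := by grind
  have hsq : r₀ ^ 2 * i + r₁ ^ 2 * j + r₂ ^ 2 * k = 0 := by grind
  have hlin : r₀ * i ^ 2 + r₁ * j ^ 2 + r₂ * k ^ 2 = 0 := by grind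
  have : i * j ^ 2 = 0 := by grind
  exact mul_ne_zero hi0 (pow_ne_zero 2 hj0) this

end Algebra

/-- For `q ≥ 5` of characteristic `≠ 3`, `a ∈ F_q*`, `r ∈ F_{q³} \ F_q`, the map
`x ↦ a·x + 1/(x - r) + 1/(x - r^q) + 1/(x - r^{q²})` is not injective on `F_q`. -/
theorem stmt_7 (q : ℕ) (hq : IsPrimePow q) (hq5 : 5 ≤ q)
    (F K : Type*) [Field F] [Fintype F] [Field K] [Fintype K] [Algebra F K]
    (hF : Fintype.card F = q) (hK : Fintype.card K = q ^ 3)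
    (hchar3 : ringChar F ≠ 3)
    (a : F) (ha : a ≠ 0)
    (r : K) (hr : r ∉ Set.range (algebraMap F K)) :
    ¬ Function.Injective fun x : F =>
      algebraMap F K (a * x) + (algebraMap F K x - r)⁻¹
        + (algebraMap F K x - r ^ q)⁻¹ + (algebraMap F K x - r ^ q ^ 2)⁻¹ := by
  intro hinj
  have hfin : r ^ q ^ 3 = r := by rw [← hK, FiniteField.pow_card]
  have hconj : ∀ n : ℕ, r ^ q ^ n ∉ Set.range (algebraMap F K) := by
    rintro n ⟨y, hy⟩
    have hyq : ∀ m, algebraMap F K y ^ q ^ m = algebraMap F K y := fun m => by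
      rw [← map_pow, ← hF, FiniteField.pow_card_pow]
    have hrn : ∀ m, r ^ q ^ (3 * m) = r := fun m => by
      induction m with
      | zero => simp
      | succ m ih => rw [Nat.mul_succ, pow_add, pow_mul, ih, hfin]
    refine hr ⟨y, ?_⟩
    rw [← hyq (2 * n), hy, ← pow_mul, ← pow_add, ← hrn n,
      ← pow_mul, ← pow_add, show 3 * n + (n + 2 * n) = 3 * (2 * n) by ring, hrn, hrn]
  have hr₁ : r ^ q ∉ Set.range (algebraMap F K) := by simpa using hconj 1
  have hr₂ := hconj 2
  have e₁ : (r ^ q) ^ q = r ^ q ^ 2 := by rw [← pow_mul, sq]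
  have e₂ : (r ^ q ^ 2) ^ q = r := by rw [← pow_mul, ← pow_succ, hfin]
  have three : (3 : K) ≠ 0 := by
    intro h
    have h3 : ((3 : ℕ) : F) = 0 :=
      (algebraMap F K).injective (by rw [map_natCast, map_zero]; exact_mod_cast h)
    have := (Nat.prime_dvd_prime_iff_eq (CharP.char_is_prime F (ringChar F)) Nat.prime_three).mp
      ((ringChar.spec F 3).mp h3)
    exact hchar3 this
  have sum₀ := fun k hk => sum_inv_pow_succ (F := F) hr (k := k) hk
  have sum₁ := fun k hk => sum_inv_pow_succ (F := F) hr₁ (k := k) hk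
  have sum₂ := fun k hk => sum_inv_pow_succ (F := F) hr₂ (k := k) hk
  have y₀_ne := pow_card_sub_ne_zero hr
  have y₁_ne := pow_card_sub_ne_zero hr₁
  have y₂_ne := pow_card_sub_ne_zero hr₂
  have hxne : ∀ x : F, ∀ z : K, z ∉ Set.range (algebraMap F K) → algebraMap F K x - z ≠ 0 :=
    fun x z hz h => hz ⟨x, sub_eq_zero.mp h⟩
  have hfix : ∀ x : F, (algebraMap F K (a * x) + (algebraMap F K x - r)⁻¹
        + (algebraMap F K x - r ^ q)⁻¹ + (algebraMap F K x - r ^ q ^ 2)⁻¹) ^ Fintype.card F =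
      algebraMap F K (a * x) + (algebraMap F K x - r)⁻¹
        + (algebraMap F K x - r ^ q)⁻¹ + (algebraMap F K x - r ^ q ^ 2)⁻¹ := by
    intro x
    have hφ : ∀ z : K, z ^ Fintype.card F = FiniteField.frobeniusAlgHom F K z := fun z => rfl
    rw [hφ, map_add, map_add, map_add, map_inv₀, map_inv₀, map_inv₀, map_sub, map_sub, map_sub,
      AlgHom.commutes, AlgHom.commutes, ← hφ, ← hφ, ← hφ, hF, e₁, e₂]
    ring
  have hsum := fun k hk => sum_pow_eq_zero_of_injective hinj hfix (k := k) hk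
  have hxsum : ∀ k, k < Fintype.card F - 1 → ∑ x : F, algebraMap F K x ^ k = 0 := fun k hk => by
    simpa using sum_algebraMap_sub_pow_eq_zero (F := F) (0 : K) hk
  simp only [map_mul] at hsum
  have hA : algebraMap F K a ≠ 0 := by simpa using ha
  rw [hF] at sum₀ sum₁ sum₂ y₀_ne y₁_ne y₂_ne hsum hxsum
  rw [e₁] at sum₁ y₁_ne
  rw [e₂] at sum₂ y₂_ne
  have ht : ∀ x : F, ∀ z : K, z ∉ Set.range (algebraMap F K) →
      algebraMap F K x * (algebraMap F K x - z)⁻¹ = 1 + z * (algebraMap F K x - z)⁻¹ :=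
    fun x z hz => by
      have := hxne x z hz
      field_simp
      ring
  have htt : ∀ x : F, ∀ z w : K, z ∉ Set.range (algebraMap F K) →
      w ∉ Set.range (algebraMap F K) → w - z ≠ 0 →
      (algebraMap F K x - z)⁻¹ * (algebraMap F K x - w)⁻¹ =
        (w - z)⁻¹ * ((algebraMap F K x - w)⁻¹ - (algebraMap F K x - z)⁻¹) :=
    fun x z w hz hw hzw => by
      have := hxne x z hz
      have := hxne x w hw
      field_simp
      ring
  have ht₀ := fun x : F => ht x r hr
  have ht₁ := fun x : F => ht x _ hr₁
  have ht₂ := fun x : F => ht x _ hr₂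
  have ht₀₁ := fun x : F => htt x _ _ hr hr₁ y₀_ne
  have ht₁₂ := fun x : F => htt x _ _ hr₁ hr₂ y₁_ne
  have ht₂₀ := fun x : F => htt x _ _ hr₂ hr y₂_ne
  have S₀ := sum₀ 0 (by omega)
  have S₁ := sum₁ 0 (by omega)
  have S₂ := sum₂ 0 (by omega)
  simp only [zero_add, pow_one] at S₀ S₁ S₂
  have s1 := hsum 1 (by omega)
  have X1 := hxsum 1 (by omega)
  simp only [pow_one] at s1 X1
  simp only [Finset.sum_add_distrib, ← Finset.mul_sum, X1, S₀, S₁, S₂, mul_zero, zero_add] at s1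
  have s2 := hsum 2 (by omega)
  simp only [fun x => sq_conjugate_sum_expand (a := algebraMap F K a)
    (ht₀ x) (ht₁ x) (ht₂ x) (ht₀₁ x) (ht₁₂ x) (ht₂₀ x)] at s2
  simp only [Finset.sum_add_distrib, Finset.sum_sub_distrib, ← Finset.mul_sum, S₀, S₁, S₂,
    sum₀ 1 (by omega), sum₁ 1 (by omega), sum₂ 1 (by omega), hxsum 2 (by omega),
    hxsum 0 (by omega), mul_zero, zero_add] at s2
  have two := two_eq_zero_of_sq_sum hA three y₀_ne y₁_ne y₂_ne s1 s2
  have hq6 : 3 < q - 1 := by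
    have hqK : ((q : ℕ) : K) = 0 := by
      rw [← hF, ← map_natCast (algebraMap F K), FiniteField.cast_card_eq_zero, map_zero]
    rcases hq5.eq_or_lt with rfl | h
    · exact absurd (by push_cast at hqK; linear_combination hqK - 2 * two) (one_ne_zero (α := K))
    · omega
  have s3 := hsum 3 hq6
  simp only [fun x => cube_conjugate_sum_expand (a := algebraMap F K a) two
    (ht₀ x) (ht₁ x) (ht₂ x) (ht₀₁ x) (ht₁₂ x) (ht₂₀ x)] at s3
  simp only [Finset.sum_add_distrib, ← Finset.mul_sum, S₀, S₁, S₂,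
    sum₀ 1 (by omega), sum₁ 1 (by omega), sum₂ 1 (by omega),
    sum₀ 2 (by omega), sum₁ 2 (by omega), sum₂ 2 (by omega), hxsum 3 hq6,
    hxsum 1 (by omega), hxsum 0 (by omega), mul_zero, zero_add] at s3
  exact cube_sum_ne_zero two y₀_ne y₁_ne y₂_ne s1 s3
end

section
/- Let p ∈ {2, 3}, let q = p^n for some n ≥ 1, and let δ ∈ F_q with Tr_{q/p}(δ) ≠ 0, where Tr_{q/p} is the trace from F_q to F_p. Then x^p − x + δ ≠ 0 for every x ∈ F_q, and the map from F_q to F_q sending x to x + 1/(x^p − x + δ) is a bijection of F_q. -/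
/-- An element of the form `z - z ^ p` of a field with `p ^ n` elements has absolute trace zero. -/
theorem sum_sub_pow_pow_eq_zero {p n : ℕ} {F : Type*} [Field F] [Fintype F] [Fact p.Prime]
    [CharP F p] (hF : Fintype.card F = p ^ n) (z : F) :
    ∑ i ∈ Finset.range n, (z - z ^ p) ^ p ^ i = 0 := by
  have h : ∀ i, (z - z ^ p) ^ p ^ i = z ^ p ^ i - z ^ p ^ (i + 1) := fun i => by
    rw [sub_pow_char_pow, ← pow_mul, ← pow_succ']
  simp only [h]
  rw [Finset.sum_range_sub' (fun i => z ^ p ^ i), ← hF, FiniteField.pow_card]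
  simp

/-- In characteristic two, a solution `a` of `a * (a - (d ^ 2 - d)) = d - 1 ≠ 0` is of the form
`t ^ 2 - t`. -/
theorem exists_sq_sub_eq {F : Type*} [Field F] [CharP F 2] {a d : F} (hd : d ≠ 0)
    (he : d - 1 ≠ 0) (h : a * (a - (d ^ 2 - d)) = d - 1) : ∃ t : F, a = t ^ 2 - t := by
  have h2 : (2 : F) = 0 := CharP.cast_eq_zero F 2
  have hden : a + (d + 1) ^ 2 ≠ 0 := by
    intro h0
    have ha : a = (d + 1) ^ 2 := by linear_combination h0 - (d + 1) ^ 2 * h2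
    subst ha
    apply mul_ne_zero (pow_ne_zero 2 hd) he
    grind
  refine ⟨d * (d + 1) / (a + (d + 1) ^ 2), ?_⟩
  field_simp
  grind

/-- In characteristic three, a solution `a` of `a * (a - (d ^ 3 - d)) = d ^ 2 - 1` is of the form
`t ^ 3 - t`. -/
theorem exists_cube_sub_eq {F : Type*} [Field F] [CharP F 3] {a d : F}
    (h : a * (a - (d ^ 3 - d)) = d ^ 2 - 1) : ∃ t : F, a = t ^ 3 - t := by
  have h3 : (3 : F) = 0 := CharP.cast_eq_zero F 3
  by_cases hd : d ^ 2 + 1 = 0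
  · have ha : (a + d) ^ 2 = 0 := by grind
    have ha' : a + d = 0 := pow_eq_zero_iff two_ne_zero |>.mp ha
    exact ⟨-d, by grind⟩
  · obtain ⟨r, hr⟩ : ∃ r, r * (d ^ 2 + 1) = -a - d * (d ^ 2 - 1) :=
      ⟨_, div_mul_cancel₀ _ hd⟩
    have hr2 : r ^ 2 = d ^ 2 - 1 := by
      apply mul_right_cancel₀ (pow_ne_zero 2 hd)
      rw [← mul_pow, hr]
      grind
    exact ⟨-(d + r), by grind⟩

/-- For `p ∈ {2, 3}`, `q = p^n`, and `δ ∈ F_q` of nonzero absolute trace,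
`x^p - x + δ` has no root in `F_q` and `x ↦ x + 1/(x^p - x + δ)` permutes `F_q`. -/
theorem stmt_9 (p : ℕ) (hp : p = 2 ∨ p = 3) (n : ℕ) (hn : 1 ≤ n)
    (F : Type*) [Field F] [Fintype F] (hF : Fintype.card F = p ^ n)
    (δ : F) (hδ : ∑ i ∈ Finset.range n, δ ^ p ^ i ≠ 0) :
    (∀ x : F, x ^ p - x + δ ≠ 0) ∧
      Function.Bijective fun x : F => x + (x ^ p - x + δ)⁻¹ := by
  have hprime : Fact p.Prime := ⟨by rcases hp with rfl | rfl <;> norm_num⟩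
  have hchar : CharP F p := charP_of_card_eq_prime_pow hF
  have hroot : ∀ x : F, x ^ p - x + δ ≠ 0 := fun x hx => hδ <| by
    rw [show δ = x - x ^ p by linear_combination hx]
    exact sum_sub_pow_pow_eq_zero hF x
  have hrange : ∀ x t : F, x ^ p - x + δ ≠ t ^ p - t := fun x t hxt => hroot (x - t) <| by
    rw [sub_pow_char]
    linear_combination hxt
  refine ⟨hroot, Finite.injective_iff_bijective.mp fun x y hxy => ?_⟩
  by_contra hne
  have hd : x - y ≠ 0 := sub_ne_zero.mpr hne
  have hA := hroot x
  have hB := hroot y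
  have hsub : y ^ p - y + δ = (x ^ p - x + δ) - ((x - y) ^ p - (x - y)) := by
    rw [sub_pow_char]
    ring
  have hprod : (x - y) * ((x ^ p - x + δ) * (y ^ p - y + δ)) = (x - y) ^ p - (x - y) := by
    rw [sub_pow_char]
    field_simp at hxy
    linear_combination hxy
  have hAB := mul_ne_zero hA hB
  have key : ∃ t : F, x ^ p - x + δ = t ^ p - t := by
    rw [hsub] at hprod hAB
    rcases hp with rfl | rfl
    · have h := mul_left_cancel₀ hd (hprod.trans (by ring : _ = (x - y) * ((x - y) - 1)))
      exact exists_sq_sub_eq hd (h ▸ hAB) h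
    · exact exists_cube_sub_eq
        (mul_left_cancel₀ hd (hprod.trans (by ring : _ = (x - y) * ((x - y) ^ 2 - 1))))
  obtain ⟨t, ht⟩ := key
  exact hrange x t ht
end

section
/- Let q = 2^n and let c ∈ F_q with Tr_{q/2}(c) = 1, where Tr_{q/2} is the trace from F_q to F_2. Then there is no rational function P ∈ F_q(X) satisfying P + P^2 = 1 + (1 + c + c^2 + X + X^4)^3 / (c + X + X^2)^5 in F_q(X). -/
open Polynomial in
/-- In characteristic two, a unit multiple of a square is never the fifth power of a nonzero
polynomial with derivative `1`. -/
lemma not_associated_sq_pow_five {F : Type*} [Field F] [CharP F 2] {b D : F[X]}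
    (hD : D ≠ 0) (hD' : derivative D = 1) : ¬ Associated (b ^ 2) (D ^ 5) := by
  rintro ⟨u, hu⟩
  obtain ⟨r, -, hr⟩ := Polynomial.isUnit_iff.mp u.isUnit
  have h2 : (2 : F[X]) = 0 := CharTwo.two_eq_zero
  have h := congrArg derivative hu
  rw [← hr] at h
  simp only [derivative_mul, derivative_C, derivative_pow, hD'] at h
  norm_num at h
  rw [map_ofNat, map_ofNat, h2, zero_mul, zero_mul, zero_mul] at h
  have h5 : (5 : F[X]) = 1 := by
    rw [show (5 : F[X]) = 2 * 2 + 1 by norm_num, h2, zero_mul, zero_add]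
  rw [h5, one_mul] at h
  exact pow_ne_zero 4 hD h.symm

/-- For `q = 2^n` and `c ∈ F_q` with `Tr_{q/2}(c) = 1`, there is no rational function
`P ∈ F_q(X)` with `P + P² = 1 + (1 + c + c² + X + X⁴)³ / (c + X + X²)⁵`. -/
theorem stmt_10 (n : ℕ) (hn : 1 ≤ n) (q : ℕ) (hq : q = 2 ^ n)
    (F : Type*) [Field F] [Fintype F] (hF : Fintype.card F = q)
    (c : F) (hc : ∑ i ∈ Finset.range n, c ^ 2 ^ i = 1) :
    ¬ ∃ P : RatFunc F,
      P + P ^ 2 =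
        1 + (1 + RatFunc.C c + RatFunc.C c ^ 2 + RatFunc.X + RatFunc.X ^ 4) ^ 3
          / (RatFunc.C c + RatFunc.X + RatFunc.X ^ 2) ^ 5 := by
  rintro ⟨P, hP⟩
  have h2F : (2 : F) = 0 := by
    have h := FiniteField.cast_card_eq_zero F
    rw [hF, hq] at h
    push_cast at h
    exact eq_zero_of_pow_eq_zero h
  have : CharP F 2 := CharTwo.of_one_ne_zero_of_two_eq_zero one_ne_zero h2F
  have h2 : (2 : Polynomial F) = 0 := CharTwo.two_eq_zero
  obtain ⟨D, hD⟩ : ∃ D : Polynomial F,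
      D = Polynomial.C c + Polynomial.X + Polynomial.X ^ 2 := ⟨_, rfl⟩
  have hD' : Polynomial.derivative D = 1 := by
    simp [hD, one_add_one_eq_two]
    exact h2F
  have hD0 : D ≠ 0 := by
    rintro rfl
    simp at hD'
  have hN : 1 + Polynomial.C c + Polynomial.C c ^ 2 + Polynomial.X + Polynomial.X ^ 4
      = D ^ 2 + D + 1 := by
    rw [hD]
    linear_combination (-(Polynomial.C c * Polynomial.X + Polynomial.C c * Polynomial.X ^ 2
      + Polynomial.X ^ 3 + Polynomial.X ^ 2)) * h2
  have hcop := RatFunc.isCoprime_num_denom P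
  have hb0 : algebraMap (Polynomial F) (RatFunc F) P.denom ≠ 0 :=
    RatFunc.algebraMap_ne_zero P.denom_ne_zero
  have hDR0 : algebraMap (Polynomial F) (RatFunc F) D ≠ 0 := RatFunc.algebraMap_ne_zero hD0
  have hDR := congrArg (algebraMap (Polynomial F) (RatFunc F)) hD
  have hNR := congrArg (algebraMap (Polynomial F) (RatFunc F)) hN
  simp only [map_add, map_pow, map_one, RatFunc.algebraMap_C, RatFunc.algebraMap_X] at hDR hNR
  rw [hNR, ← hDR, ← RatFunc.num_div_denom P] at hP
  generalize P.num = a at *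
  generalize P.denom = b at *
  have key : a * (a + b) * D ^ 5 = b ^ 2 * (D ^ 5 + (D ^ 2 + D + 1) ^ 3) := by
    apply RatFunc.algebraMap_injective F
    simp only [map_add, map_mul, map_pow, map_one]
    field_simp at hP
    linear_combination hP
  have hb : IsCoprime (b ^ 2) (a * (a + b)) := by
    refine IsCoprime.pow_left (hcop.symm.mul_right ?_)
    simpa using hcop.symm.add_mul_left_right 1
  have hDN : IsCoprime (D ^ 5) (D ^ 5 + (D ^ 2 + D + 1) ^ 3) := by
    refine IsCoprime.pow_left
      ⟨-(D ^ 4 + (D + 1) * ((D ^ 2 + D + 1) ^ 2 + (D ^ 2 + D + 1) + 1)), 1, ?_⟩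
    ring
  exact not_associated_sq_pow_five hD0 hD' (associated_of_dvd_dvd
    (hb.dvd_of_dvd_mul_left ⟨_, key⟩)
    (hDN.dvd_of_dvd_mul_right ⟨a * (a + b), by rw [← key]; ring⟩))
end
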